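/- Let Γ be an ω-categorical model-complete core that has a symmetric polymorphism modulo endomorphisms, i.e., a binary polymorphism f and endomorphisms e₁, e₂ with e₁(f(x,y)) = e₂(f(y,x)) for all x, y. Then no expansion of Γ by finitely many constants admits a primitive positive interpretation of the structure ({0,1}; NAE). -/

import Mathlib

/-! ### Relational structures and primitive positive formulas -/

/-- A relational structure with relation symbols `σ`, arities `ar`, and domain `D`. -/
structure RelStruct (σ : Type) (ar : σ → ℕ) (D : Type) where
  rel : (s : σ) → (Fin (ar s) → D) → Prop

/-- Primitive positive formulas over the relational signature `(σ, ar)`, with `n` free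
variables (built from atomic formulas using only conjunction and existential
quantification). -/
inductive PPFormula (σ : Type) (ar : σ → ℕ) : ℕ → Type
  | eq {n : ℕ} (i j : Fin n) : PPFormula σ ar n
  | rel {n : ℕ} (s : σ) (v : Fin (ar s) → Fin n) : PPFormula σ ar n
  | and {n : ℕ} (φ ψ : PPFormula σ ar n) : PPFormula σ ar n
  | ex {n : ℕ} (φ : PPFormula σ ar (n + 1)) : PPFormula σ ar n

/-- Satisfaction of a primitive positive formula in a structure, under an assignment. -/
def PPFormula.Realize {σ : Type} {ar : σ → ℕ} {D : Type} (Γ : RelStruct σ ar D) :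
    {n : ℕ} → PPFormula σ ar n → (Fin n → D) → Prop
  | _, .eq i j, t => t i = t j
  | _, .rel s v, t => Γ.rel s (fun m => t (v m))
  | _, .and φ ψ, t => φ.Realize Γ t ∧ ψ.Realize Γ t
  | _, .ex φ, t => ∃ d : D, φ.Realize Γ (Fin.snoc t d)

/-- A relation is primitive positive definable in `Γ` if it is the set of solutions of a
primitive positive formula over the signature of `Γ`. -/
def PPDefinable {σ : Type} {ar : σ → ℕ} {D : Type} (Γ : RelStruct σ ar D) {n : ℕ}
    (R : (Fin n → D) → Prop) : Prop :=
  ∃ φ : PPFormula σ ar n, ∀ t, R t ↔ φ.Realize Γ t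

/-- The expansion of a structure by the constants `a 0, …, a (n-1)`, realised as new
singleton unary relations. -/
def RelStruct.withConstants {σ : Type} {ar : σ → ℕ} {D : Type} (Γ : RelStruct σ ar D)
    {n : ℕ} (a : Fin n → D) : RelStruct (σ ⊕ Fin n) (Sum.elim ar fun _ => 1) D where
  rel s := match s with
    | .inl s => fun t => Γ.rel s t
    | .inr i => fun t : Fin 1 → D => t 0 = a i

/-- Flattening a `k`-tuple of `d`-tuples into a `(k*d)`-tuple. -/
def flattenTuple {D : Type} {k d : ℕ} (ts : Fin k → Fin d → D) : Fin (k * d) → D :=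
  fun j => ts (finProdFinEquiv.symm j).1 (finProdFinEquiv.symm j).2

/-- A primitive positive interpretation of the structure `Δ` in the structure `Γ`:
a dimension `dim`, a primitive positive domain formula, primitive positive defining
formulas for equality and for each atomic formula, and a coordinate map, surjective
onto `Δ`, from the `dim`-tuples satisfying the domain formula. -/
structure PPInterpretation {σ₁ : Type} {ar₁ : σ₁ → ℕ} {D : Type} (Γ : RelStruct σ₁ ar₁ D)
    {σ₂ : Type} {ar₂ : σ₂ → ℕ} {E : Type} (Δ : RelStruct σ₂ ar₂ E) : Type where
  dim : ℕ
  domFml : PPFormula σ₁ ar₁ dim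
  eqFml : PPFormula σ₁ ar₁ (2 * dim)
  relFml : (s : σ₂) → PPFormula σ₁ ar₁ (ar₂ s * dim)
  coord : (Fin dim → D) → E
  coord_surj : ∀ e : E, ∃ t, domFml.Realize Γ t ∧ coord t = e
  eq_iff : ∀ t₁ t₂ : Fin dim → D, domFml.Realize Γ t₁ → domFml.Realize Γ t₂ →
    (coord t₁ = coord t₂ ↔ eqFml.Realize Γ (flattenTuple ![t₁, t₂]))
  rel_iff : ∀ (s : σ₂) (ts : Fin (ar₂ s) → Fin dim → D),
    (∀ i, domFml.Realize Γ (ts i)) →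
    (Δ.rel s (fun i => coord (ts i)) ↔ (relFml s).Realize Γ (flattenTuple ts))

/-- The Boolean structure `({0,1}; NAE)`, where `NAE = {0,1}³ \ {(0,0,0),(1,1,1)}`. -/
def NAEStruct : RelStruct Unit (fun _ => 3) Bool where
  rel := fun _ t => (∃ i, t i = true) ∧ (∃ i, t i = false)
/-! ### First-order formulas, ω-categoricity, model-complete cores -/

/-- First-order formulas over the relational signature `(σ, ar)` with `n` free variables. -/
inductive FOFormula (σ : Type) (ar : σ → ℕ) : ℕ → Type
  | eq {n : ℕ} (i j : Fin n) : FOFormula σ ar n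
  | rel {n : ℕ} (s : σ) (v : Fin (ar s) → Fin n) : FOFormula σ ar n
  | not {n : ℕ} (φ : FOFormula σ ar n) : FOFormula σ ar n
  | and {n : ℕ} (φ ψ : FOFormula σ ar n) : FOFormula σ ar n
  | ex {n : ℕ} (φ : FOFormula σ ar (n + 1)) : FOFormula σ ar n

/-- Satisfaction of a first-order formula in a structure, under an assignment. -/
def FOFormula.Realize {σ : Type} {ar : σ → ℕ} {D : Type} (Γ : RelStruct σ ar D) :
    {n : ℕ} → FOFormula σ ar n → (Fin n → D) → Prop
  | _, .eq i j, t => t i = t j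
  | _, .rel s v, t => Γ.rel s (fun m => t (v m))
  | _, .not φ, t => ¬ φ.Realize Γ t
  | _, .and φ ψ, t => φ.Realize Γ t ∧ ψ.Realize Γ t
  | _, .ex φ, t => ∃ d : D, φ.Realize Γ (Fin.snoc t d)

/-- A relation is first-order definable in `Γ` if it is the set of solutions of a
first-order formula over the signature of `Γ`. -/
def FODefinable {σ : Type} {ar : σ → ℕ} {D : Type} (Γ : RelStruct σ ar D) {n : ℕ}
    (R : (Fin n → D) → Prop) : Prop :=
  ∃ φ : FOFormula σ ar n, ∀ t, R t ↔ φ.Realize Γ t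

/-- Isomorphism of relational structures over the same signature. -/
def RelStruct.Isomorphic {σ : Type} {ar : σ → ℕ} {D E : Type}
    (Γ : RelStruct σ ar D) (Δ : RelStruct σ ar E) : Prop :=
  ∃ g : D ≃ E, ∀ (s : σ) (t : Fin (ar s) → D), Γ.rel s t ↔ Δ.rel s (fun i => g (t i))

/-- A countable structure is ω-categorical if all countable models of its first-order
theory are isomorphic (to it). -/
def IsOmegaCategorical {σ : Type} {ar : σ → ℕ} {D : Type} (Γ : RelStruct σ ar D) : Prop :=
  Countable D ∧ ∀ (E : Type) (Δ : RelStruct σ ar E), Countable E →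
    (∀ φ : FOFormula σ ar 0, φ.Realize Γ Fin.elim0 → φ.Realize Δ Fin.elim0) →
    Γ.Isomorphic Δ

/-- A self-map of the domain of `Γ` is an elementary self-embedding if it preserves the
truth of all first-order formulas. -/
def IsElementarySelfEmbedding {σ : Type} {ar : σ → ℕ} {D : Type} (Γ : RelStruct σ ar D)
    (e : D → D) : Prop :=
  ∀ {n : ℕ} (φ : FOFormula σ ar n) (t : Fin n → D),
    φ.Realize Γ t ↔ φ.Realize Γ (fun i => e (t i))

/-- A homomorphism between relational structures over the same signature. -/
def IsHom {σ : Type} {ar : σ → ℕ} {D E : Type} (Γ : RelStruct σ ar D) (Δ : RelStruct σ ar E)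
    (h : D → E) : Prop :=
  ∀ (s : σ) (t : Fin (ar s) → D), Γ.rel s t → Δ.rel s (fun i => h (t i))

/-- Two structures are homomorphically equivalent if there are homomorphisms in both
directions. -/
def HomEquiv {σ : Type} {ar : σ → ℕ} {D E : Type} (Γ : RelStruct σ ar D)
    (Δ : RelStruct σ ar E) : Prop :=
  (∃ h, IsHom Γ Δ h) ∧ (∃ h, IsHom Δ Γ h)

/-- A structure is a model-complete core if all its endomorphisms are elementary
self-embeddings. -/
def IsModelCompleteCore {σ : Type} {ar : σ → ℕ} {D : Type} (Γ : RelStruct σ ar D) : Prop :=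
  ∀ e : D → D, IsHom Γ Γ e → IsElementarySelfEmbedding Γ e
/-! ### Polymorphisms and endomorphisms -/

/-- A `k`-ary operation `f` preserves an `m`-ary relation `R` if applying `f`
componentwise to `k` tuples of `R` yields a tuple of `R`. -/
def PreservesRel {D : Type} {k m : ℕ} (f : (Fin k → D) → D) (R : (Fin m → D) → Prop) : Prop :=
  ∀ ts : Fin k → Fin m → D, (∀ i, R (ts i)) → R (fun j => f (fun i => ts i j))

/-- A polymorphism of `Γ` is a finitary operation on the domain preserving all
relations of `Γ`. -/
def IsPolymorphism {σ : Type} {ar : σ → ℕ} {D : Type} (Γ : RelStruct σ ar D) {k : ℕ}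
    (f : (Fin k → D) → D) : Prop :=
  ∀ s, PreservesRel f (Γ.rel s)

/-- A binary operation as an operation on `Fin 2`-tuples. -/
def binOp {D : Type} (f : D → D → D) : (Fin 2 → D) → D := fun t => f (t 0) (t 1)

/-- An endomorphism of `Γ` (a unary polymorphism). -/
def IsEndomorphism {σ : Type} {ar : σ → ℕ} {D : Type} (Γ : RelStruct σ ar D)
    (e : D → D) : Prop :=
  ∀ (s : σ) (t : Fin (ar s) → D), Γ.rel s t → Γ.rel s (fun i => e (t i))

/-- `Γ` has a symmetric polymorphism modulo endomorphisms: a binary polymorphism `f`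
and endomorphisms `e₁, e₂` with `e₁(f(x,y)) = e₂(f(y,x))` for all `x, y`. -/
def HasSymmetricPolymorphismModEndos {σ : Type} {ar : σ → ℕ} {D : Type}
    (Γ : RelStruct σ ar D) : Prop :=
  ∃ (f : D → D → D) (e₁ e₂ : D → D),
    IsPolymorphism Γ (binOp f) ∧ IsEndomorphism Γ e₁ ∧ IsEndomorphism Γ e₂ ∧
    ∀ x y, e₁ (f x y) = e₂ (f y x)

theorem pp_preserve {σ : Type} {ar : σ → ℕ} {D : Type} (Γ : RelStruct σ ar D) (f : D → D → D)
    (hf : ∀ s t₁ t₂, Γ.rel s t₁ → Γ.rel s t₂ → Γ.rel s (fun i => f (t₁ i) (t₂ i)))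
    {n : ℕ} (a b : Fin n → D) {m : ℕ} (φ : PPFormula (σ ⊕ Fin n) (Sum.elim ar fun _ => 1) m) :
    ∀ t₁ t₂ : Fin m → D, φ.Realize (Γ.withConstants a) t₁ → φ.Realize (Γ.withConstants b) t₂ →
      φ.Realize (Γ.withConstants (fun i => f (a i) (b i))) (fun i => f (t₁ i) (t₂ i)) := by
  induction φ with
  | eq i j =>
    intro t₁ t₂ h₁ h₂
    simp only [PPFormula.Realize] at *
    rw [h₁, h₂]
  | rel s v =>
    intro t₁ t₂ h₁ h₂
    cases s with
    | inl s => exact hf s _ _ h₁ h₂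
    | inr i =>
      change f (t₁ (v (0 : Fin 1))) (t₂ (v (0 : Fin 1))) = f (a i) (b i)
      have h₁ : t₁ (v (0 : Fin 1)) = a i := h₁
      have h₂ : t₂ (v (0 : Fin 1)) = b i := h₂
      rw [h₁, h₂]
  | and φ ψ ih₁ ih₂ =>
    intro t₁ t₂ h₁ h₂
    exact ⟨ih₁ _ _ h₁.1 h₂.1, ih₂ _ _ h₁.2 h₂.2⟩
  | ex φ ih =>
    rintro t₁ t₂ ⟨d₁, h₁⟩ ⟨d₂, h₂⟩
    refine ⟨f d₁ d₂, ?_⟩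
    convert ih _ _ h₁ h₂ using 1
    funext i
    refine Fin.lastCases ?_ (fun i => ?_) i <;> simp

/-- Translation of pp formulas with constants into first-order formulas. -/
def PPFormula.trFO {σ : Type} {ar : σ → ℕ} {n : ℕ} :
    {k : ℕ} → PPFormula (σ ⊕ Fin n) (Sum.elim ar fun _ => 1) k →
    {m : ℕ} → (Fin k → Fin m) → (Fin n → Fin m) → FOFormula σ ar m
  | _, .eq i j, _, v, _ => .eq (v i) (v j)
  | _, .rel (.inl s) w, _, v, _ => .rel s (fun i => v (w i))
  | _, .rel (.inr i) w, _, v, c => .eq (v (w (0 : Fin 1))) (c i)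
  | _, .and φ ψ, _, v, c => .and (φ.trFO v c) (ψ.trFO v c)
  | _, .ex φ, m, v, c => .ex (φ.trFO (Fin.snoc (fun i => (v i).castSucc) (Fin.last m))
      (fun i => (c i).castSucc))

theorem trFO_realize {σ : Type} {ar : σ → ℕ} {D : Type} (Γ : RelStruct σ ar D) {n : ℕ}
    {k : ℕ} (φ : PPFormula (σ ⊕ Fin n) (Sum.elim ar fun _ => 1) k) :
    ∀ {m : ℕ} (v : Fin k → Fin m) (c : Fin n → Fin m) (t : Fin m → D),
      (φ.trFO v c).Realize Γ t ↔
        φ.Realize (Γ.withConstants (fun i => t (c i))) (fun i => t (v i)) := by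
  induction φ with
  | eq i j => intro m v c t; rfl
  | rel s w =>
    intro m v c t
    cases s with
    | inl s => rfl
    | inr i => rfl
  | and φ ψ ih₁ ih₂ =>
    intro m v c t
    exact and_congr (ih₁ v c t) (ih₂ v c t)
  | ex φ ih =>
    intro m v c t
    refine exists_congr fun d => ?_
    rw [ih]
    have h1 : (fun i => (Fin.snoc t d : Fin (m + 1) → D) ((c i).castSucc)) = fun i => t (c i) := by
      funext i; simp
    have h2 : (fun i => (Fin.snoc t d : Fin (m + 1) → D)
        ((Fin.snoc (fun i => (v i).castSucc) (Fin.last m) : Fin _ → Fin (m + 1)) i))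
        = Fin.snoc (fun i => t (v i)) d := by
      funext i
      refine Fin.lastCases ?_ (fun i => ?_) i <;> simp
    rw [h1, h2]

theorem exN_exists {σ : Type} {ar : σ → ℕ} {D : Type} (Γ : RelStruct σ ar D) {n : ℕ} (k : ℕ) :
    ∀ φ : FOFormula σ ar (n + k), ∃ ψ : FOFormula σ ar n, ∀ t : Fin n → D,
      ψ.Realize Γ t ↔ ∃ u : Fin k → D, φ.Realize Γ (Fin.append t u) := by
  induction k with
  | zero =>
    intro φ
    refine ⟨φ, fun t => ?_⟩
    constructor
    · intro h
      refine ⟨Fin.elim0, ?_⟩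
      simpa using h
    · rintro ⟨u, h⟩
      have : u = Fin.elim0 := funext fun i => i.elim0
      subst this
      simpa using h
  | succ k ih =>
    intro φ
    obtain ⟨ψ, hψ⟩ := ih (.ex φ)
    refine ⟨ψ, fun t => ?_⟩
    rw [hψ]
    constructor
    · rintro ⟨u, d, h⟩
      refine ⟨Fin.snoc u d, ?_⟩
      rw [Fin.append_snoc]; exact h
    · rintro ⟨u, h⟩
      refine ⟨Fin.init u, u (Fin.last k), ?_⟩
      rw [← Fin.append_snoc, Fin.snoc_init_self]; exact h

theorem elem_transfer {σ : Type} {ar : σ → ℕ} {D : Type} (Γ : RelStruct σ ar D) (e : D → D)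
    (he : IsElementarySelfEmbedding Γ e) {n : ℕ} (a : Fin n → D) {k : ℕ}
    (φ : FOFormula σ ar (n + k))
    (h : ∃ u : Fin k → D, φ.Realize Γ (Fin.append (fun i => e (a i)) u)) :
    ∃ u : Fin k → D, φ.Realize Γ (Fin.append a u) := by
  obtain ⟨ψ, hψ⟩ := exN_exists Γ k φ
  rw [← hψ] at h ⊢
  exact (he ψ a).2 h

/-- A property of three `d`-tuples, evaluated with parameters. -/
theorem elem_transfer3 {σ : Type} {ar : σ → ℕ} {D : Type} (Γ : RelStruct σ ar D) (e : D → D)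
    (he : IsElementarySelfEmbedding Γ e) {n : ℕ} (a : Fin n → D) {d : ℕ}
    (dom : PPFormula (σ ⊕ Fin n) (Sum.elim ar fun _ => 1) d)
    (eqv : PPFormula (σ ⊕ Fin n) (Sum.elim ar fun _ => 1) (2 * d))
    (nae : PPFormula (σ ⊕ Fin n) (Sum.elim ar fun _ => 1) (3 * d)) :
    ((∀ x y z, dom.Realize (Γ.withConstants a) x → dom.Realize (Γ.withConstants a) y →
        dom.Realize (Γ.withConstants a) z →
        nae.Realize (Γ.withConstants a) (flattenTuple ![x, x, y]) →
        ¬ (¬ eqv.Realize (Γ.withConstants a) (flattenTuple ![z, x]) ∧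
          ¬ eqv.Realize (Γ.withConstants a) (flattenTuple ![z, y]))) →
      (∀ x y z, dom.Realize (Γ.withConstants (fun i => e (a i))) x →
        dom.Realize (Γ.withConstants (fun i => e (a i))) y →
        dom.Realize (Γ.withConstants (fun i => e (a i))) z →
        nae.Realize (Γ.withConstants (fun i => e (a i))) (flattenTuple ![x, x, y]) →
        ¬ (¬ eqv.Realize (Γ.withConstants (fun i => e (a i))) (flattenTuple ![z, x]) ∧
          ¬ eqv.Realize (Γ.withConstants (fun i => e (a i))) (flattenTuple ![z, y])))) ∧
    ((∀ x y z, dom.Realize (Γ.withConstants a) x → dom.Realize (Γ.withConstants a) y →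
        dom.Realize (Γ.withConstants a) z →
        nae.Realize (Γ.withConstants a) (flattenTuple ![x, x, y]) →
        ¬ (eqv.Realize (Γ.withConstants a) (flattenTuple ![z, x]) ∧
          eqv.Realize (Γ.withConstants a) (flattenTuple ![z, y]))) →
      (∀ x y z, dom.Realize (Γ.withConstants (fun i => e (a i))) x →
        dom.Realize (Γ.withConstants (fun i => e (a i))) y →
        dom.Realize (Γ.withConstants (fun i => e (a i))) z →
        nae.Realize (Γ.withConstants (fun i => e (a i))) (flattenTuple ![x, x, y]) →
        ¬ (eqv.Realize (Γ.withConstants (fun i => e (a i))) (flattenTuple ![z, x]) ∧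
          eqv.Realize (Γ.withConstants (fun i => e (a i))) (flattenTuple ![z, y])))) := by
  let c : Fin n → Fin (n + 3 * d) := Fin.castAdd _
  let V : Fin 3 → Fin d → Fin (n + 3 * d) := fun i j => Fin.natAdd n (finProdFinEquiv (i, j))
  have key : ∀ (b : Fin n → D) (ts : Fin 3 → Fin d → D) {l : ℕ} (w : Fin l → Fin 3)
      (φ : PPFormula (σ ⊕ Fin n) (Sum.elim ar fun _ => 1) (l * d)),
      (φ.trFO (flattenTuple (fun i => V (w i))) c).Realize Γ (Fin.append b (flattenTuple ts)) ↔
        φ.Realize (Γ.withConstants b) (flattenTuple (fun i => ts (w i))) := by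
    intro b ts l w φ
    rw [trFO_realize]
    simp [c, V, flattenTuple]
    rfl
  have key1 : ∀ (b : Fin n → D) (ts : Fin 3 → Fin d → D) (i : Fin 3)
      (φ : PPFormula (σ ⊕ Fin n) (Sum.elim ar fun _ => 1) d),
      (φ.trFO (V i) c).Realize Γ (Fin.append b (flattenTuple ts)) ↔
        φ.Realize (Γ.withConstants b) (ts i) := by
    intro b ts i φ
    rw [trFO_realize]
    simp [c, V, flattenTuple]
  have flat : ∀ u : Fin (3 * d) → D, ∃ ts : Fin 3 → Fin d → D, u = flattenTuple ts := by
    intro u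
    refine ⟨fun i j => u (finProdFinEquiv (i, j)), ?_⟩
    funext j
    exact congrArg u (finProdFinEquiv.apply_symm_apply j).symm
  have w3 : ∀ ts : Fin 3 → Fin d → D, (fun i => ts ((![0, 0, 1] : Fin 3 → Fin 3) i)) = ![ts 0, ts 0, ts 1] := by
    intro ts; funext i; fin_cases i <;> rfl
  have w20 : ∀ ts : Fin 3 → Fin d → D, (fun i => ts ((![2, 0] : Fin 2 → Fin 3) i)) = ![ts 2, ts 0] := by
    intro ts; funext i; fin_cases i <;> rfl
  have w21 : ∀ ts : Fin 3 → Fin d → D, (fun i => ts ((![2, 1] : Fin 2 → Fin 3) i)) = ![ts 2, ts 1] := by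
    intro ts; funext i; fin_cases i <;> rfl
  let A : FOFormula σ ar (n + 3 * d) := .and (dom.trFO (V 0) c) (.and (dom.trFO (V 1) c)
    (.and (dom.trFO (V 2) c)
      (nae.trFO (flattenTuple (fun i => V ((![0, 0, 1] : Fin 3 → Fin 3) i))) c)))
  let E0 : FOFormula σ ar (n + 3 * d) :=
    eqv.trFO (flattenTuple (fun i => V ((![2, 0] : Fin 2 → Fin 3) i))) c
  let E1 : FOFormula σ ar (n + 3 * d) :=
    eqv.trFO (flattenTuple (fun i => V ((![2, 1] : Fin 2 → Fin 3) i))) c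
  constructor
  · intro H x y z hx hy hz hn hE
    obtain ⟨u, hu⟩ := elem_transfer Γ e he a (.and A (.and (.not E0) (.not E1)))
      ⟨flattenTuple ![x, y, z], by
        simp only [A, E0, E1, FOFormula.Realize, key, key1, w3, w20, w21]
        exact ⟨⟨hx, hy, hz, hn⟩, hE⟩⟩
    obtain ⟨ts, rfl⟩ := flat u
    simp only [A, E0, E1, FOFormula.Realize, key, key1, w3, w20, w21] at hu
    exact H _ _ _ hu.1.1 hu.1.2.1 hu.1.2.2.1 hu.1.2.2.2 hu.2
  · intro H x y z hx hy hz hn hE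
    obtain ⟨u, hu⟩ := elem_transfer Γ e he a (.and A (.and E0 E1))
      ⟨flattenTuple ![x, y, z], by
        simp only [A, E0, E1, FOFormula.Realize, key, key1, w3, w20, w21]
        exact ⟨⟨hx, hy, hz, hn⟩, hE⟩⟩
    obtain ⟨ts, rfl⟩ := flat u
    simp only [A, E0, E1, FOFormula.Realize, key, key1, w3, w20, w21] at hu
    exact H _ _ _ hu.1.1 hu.1.2.1 hu.1.2.2.1 hu.1.2.2.2 hu.2

theorem flat_map2 {D : Type} (f : D → D → D) {d : ℕ} (x x' y y' : Fin d → D) :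
    (fun i => f (flattenTuple ![x, y] i) (flattenTuple ![x', y'] i)) =
      flattenTuple ![fun i => f (x i) (x' i), fun i => f (y i) (y' i)] := by
  funext i
  simp only [flattenTuple]
  generalize (finProdFinEquiv.symm i).1 = j
  fin_cases j <;> rfl

theorem flat_map3 {D : Type} (f : D → D → D) {d : ℕ} (x x' y y' z z' : Fin d → D) :
    (fun i => f (flattenTuple ![x, y, z] i) (flattenTuple ![x', y', z'] i)) =
      flattenTuple ![fun i => f (x i) (x' i), fun i => f (y i) (y' i),
        fun i => f (z i) (z' i)] := by
  funext i
  simp only [flattenTuple]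
  generalize (finProdFinEquiv.symm i).1 = j
  fin_cases j <;> rfl

/-- **No pp interpretation of NAE with parameters.**
Let `Γ` be an ω-categorical model-complete core that has a symmetric polymorphism
modulo endomorphisms. Then no expansion of `Γ` by finitely many constants admits a
primitive positive interpretation of `({0,1}; NAE)`. -/
theorem no_pp_interpretation_of_NAE_with_parameters
    (σ : Type) (ar : σ → ℕ) (D : Type) (Γ : RelStruct σ ar D)
    (hcat : IsOmegaCategorical Γ) (hcore : IsModelCompleteCore Γ)
    (hsym : HasSymmetricPolymorphismModEndos Γ)
    (n : ℕ) (a : Fin n → D) :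
    IsEmpty (PPInterpretation (Γ.withConstants a) NAEStruct) := by
  obtain ⟨f, e₁, e₂, hf, he₁, he₂, hs⟩ := hsym
  have hf2 : ∀ s t₁ t₂, Γ.rel s t₁ → Γ.rel s t₂ → Γ.rel s (fun i => f (t₁ i) (t₂ i)) := by
    intro s t₁ t₂ h₁ h₂
    refine hf s ![t₁, t₂] (fun i => ?_)
    fin_cases i
    · exact h₁
    · exact h₂
  refine ⟨fun I => ?_⟩
  obtain ⟨d, dom, eqv, nae, co, surj, heq, hrel⟩ := I
  replace hrel := hrel ()
  generalize nae () = N at hrel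
  change PPFormula _ _ (3 * d) at N
  have hneq : ∀ x y, dom.Realize (Γ.withConstants a) x → dom.Realize (Γ.withConstants a) y →
      (N.Realize (Γ.withConstants a) (flattenTuple ![x, x, y]) ↔ co x ≠ co y) := by
    intro x y hx hy
    have h := hrel ![x, x, y] (by
      intro i
      change Fin 3 at i
      fin_cases i
      · exact hx
      · exact hx
      · exact hy)
    refine h.symm.trans ?_
    change ((∃ i : Fin 3, co ((![x, x, y] : Fin 3 → Fin d → D) i) = true) ∧
      (∃ i : Fin 3, co ((![x, x, y] : Fin 3 → Fin d → D) i) = false)) ↔ _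
    simp only [Fin.exists_fin_succ, Matrix.cons_val_zero, Matrix.cons_val_succ]
    cases co x <;> cases co y <;> simp
  have T1 : ∀ x y z, dom.Realize (Γ.withConstants a) x → dom.Realize (Γ.withConstants a) y →
        dom.Realize (Γ.withConstants a) z →
        N.Realize (Γ.withConstants a) (flattenTuple ![x, x, y]) →
        ¬ (¬ eqv.Realize (Γ.withConstants a) (flattenTuple ![z, x]) ∧
          ¬ eqv.Realize (Γ.withConstants a) (flattenTuple ![z, y])) := by
    intro x y z hx hy hz h
    rw [hneq x y hx hy] at h
    rw [← heq z x hz hx, ← heq z y hz hy]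
    revert h
    cases co x <;> cases co y <;> cases co z <;> simp
  have T2 : ∀ x y z, dom.Realize (Γ.withConstants a) x → dom.Realize (Γ.withConstants a) y →
        dom.Realize (Γ.withConstants a) z →
        N.Realize (Γ.withConstants a) (flattenTuple ![x, x, y]) →
        ¬ (eqv.Realize (Γ.withConstants a) (flattenTuple ![z, x]) ∧
          eqv.Realize (Γ.withConstants a) (flattenTuple ![z, y])) := by
    intro x y z hx hy hz h
    rw [hneq x y hx hy] at h
    rw [← heq z x hz hx, ← heq z y hz hy]
    rintro ⟨h1, h2⟩
    exact h (h1.symm.trans h2)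
  have hd : IsHom Γ Γ (fun x => f x x) := fun s t h => hf2 s t t h h
  have hE : IsHom Γ Γ (fun x => e₂ (f x x)) := fun s t h => he₂ s _ (hd s t h)
  replace T1 := (elem_transfer3 Γ (fun x => f x x) (hcore _ hd) a dom eqv N).1 T1
  replace T2 := (elem_transfer3 Γ (fun x => e₂ (f x x)) (hcore _ hE) a dom eqv N).2 T2
  have P : ∀ {m : ℕ} (φ : PPFormula (σ ⊕ Fin n) (Sum.elim ar fun _ => 1) m) (t₁ t₂ : Fin m → D),
      φ.Realize (Γ.withConstants a) t₁ → φ.Realize (Γ.withConstants a) t₂ →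
      φ.Realize (Γ.withConstants (fun i => f (a i) (a i))) (fun i => f (t₁ i) (t₂ i)) :=
    fun φ t₁ t₂ => pp_preserve Γ f hf2 a a φ t₁ t₂
  have Q2 : ∀ {m : ℕ} (φ : PPFormula (σ ⊕ Fin n) (Sum.elim ar fun _ => 1) m) (t : Fin m → D),
      φ.Realize (Γ.withConstants (fun i => f (a i) (a i))) t →
      φ.Realize (Γ.withConstants (fun i => e₂ (f (a i) (a i)))) (fun i => e₂ (t i)) :=
    fun φ t h => pp_preserve Γ (fun x _ => e₂ x) (fun s t _ h _ => he₂ s t h) _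
      (fun i => f (a i) (a i)) φ t t h h
  have Q1 : ∀ {m : ℕ} (φ : PPFormula (σ ⊕ Fin n) (Sum.elim ar fun _ => 1) m) (t : Fin m → D),
      φ.Realize (Γ.withConstants (fun i => f (a i) (a i))) t →
      φ.Realize (Γ.withConstants (fun i => e₂ (f (a i) (a i)))) (fun i => e₁ (t i)) := by
    intro m φ t h
    have := pp_preserve Γ (fun x _ => e₁ x) (fun s t _ h _ => he₁ s t h) _
      (fun i => f (a i) (a i)) φ t t h h
    simpa only [hs] using this
  obtain ⟨s, hsd, hs0⟩ := surj false
  obtain ⟨t, htd, ht1⟩ := surj true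
  have n1 := (hneq s t hsd htd).2 (by simp [hs0, ht1])
  have n2 := (hneq t s htd hsd).2 (by simp [hs0, ht1])
  have np := P N _ _ n1 n2
  rw [flat_map3] at np
  have np' := Q2 N _ np
  rw [flat_map3 (fun x _ => e₂ x) _ (fun i => f (s i) (t i)) _ (fun i => f (s i) (t i)) _ (fun i => f (s i) (t i))] at np'
  have dp := P dom _ _ hsd htd
  have dq := P dom _ _ htd hsd
  have dz := P dom _ _ hsd hsd
  have T2' := T2 _ _ (fun i => e₂ (f (s i) (s i))) (Q2 dom _ dp) (Q2 dom _ dq) (Q2 dom _ dz) np'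
  apply T1 _ _ _ dp dq dz np
  have R1 : ∀ x y : Fin d → D, eqv.Realize (Γ.withConstants (fun i => f (a i) (a i)))
      (flattenTuple ![x, y]) → eqv.Realize (Γ.withConstants (fun i => e₂ (f (a i) (a i))))
      (flattenTuple ![fun i => e₁ (x i), fun i => e₁ (y i)]) := by
    intro x y h
    have := Q1 eqv _ h
    rwa [flat_map2 (fun x _ => e₁ x) x x y y] at this
  have R2 : ∀ x y : Fin d → D, eqv.Realize (Γ.withConstants (fun i => f (a i) (a i)))
      (flattenTuple ![x, y]) → eqv.Realize (Γ.withConstants (fun i => e₂ (f (a i) (a i))))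
      (flattenTuple ![fun i => e₂ (x i), fun i => e₂ (y i)]) := by
    intro x y h
    have := Q2 eqv _ h
    rwa [flat_map2 (fun x _ => e₂ x) x x y y] at this
  constructor
  · intro h
    have h1 := R1 _ _ h
    simp only [hs] at h1
    exact T2' ⟨R2 _ _ h, h1⟩
  · intro h
    have h1 := R1 _ _ h
    simp only [hs] at h1
    exact T2' ⟨h1, R2 _ _ h⟩
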